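/- Let n ≥ 3, let 1 ≤ k ≤ n−1, let U ⊆ ℝⁿ be open, and let σ be a smooth map from U to k-forms satisfying the flat conformal Killing equation. Define the symmetric 2-tensor S(x)(a,b) := Σ_{p₂,…,pₖ=1}^{n} σ(x)(a,e_{p₂},…,e_{pₖ}) · σ(x)(b,e_{p₂},…,e_{pₖ}). Then the trace-free totally symmetric part of the derivative of S vanishes; explicitly, there exists a smooth map λ from U to linear functionals on ℝⁿ such that for all x ∈ U and all a, b, c ∈ ℝⁿ: (DS(x)a)(b,c) + (DS(x)b)(c,a) + (DS(x)c)(a,b) = ⟨a,b⟩λ(x)(c) + ⟨b,c⟩λ(x)(a) + ⟨c,a⟩λ(x)(b). That is, the trace-free part of S is a conformal Killing 2-tensor. -/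

import Mathlib

open scoped RealInnerProductSpace BigOperators

noncomputable section

/-- Euclidean `n`-space. -/
abbrev Euc (n : ℕ) : Type := EuclideanSpace ℝ (Fin n)

/-- Continuous `k`-linear maps `(ℝⁿ)ᵏ → ℝ`. -/
abbrev FormML (n k : ℕ) : Type :=
  ContinuousMultilinearMap ℝ (fun _ : Fin k => Euc n) ℝ

/-- A multilinear map is alternating (vanishes when two arguments coincide);
together with multilinearity this makes it a `k`-form. -/
def IsAlt {n k : ℕ} (f : FormML n k) : Prop :=
  ∀ (v : Fin k → Euc n) (i j : Fin k), i ≠ j → v i = v j → f v = 0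

/-- The tuple `a` with its `i`-th entry omitted. -/
def omitArg {X : Type*} {k : ℕ} (i : Fin k) (a : Fin k → X) (j : Fin (k - 1)) : X :=
  if (j : ℕ) < (i : ℕ) then a ⟨j, by have := j.isLt; have := i.isLt; omega⟩
  else a ⟨(j : ℕ) + 1, by have := j.isLt; omega⟩

/-- The tuple `(c, d₁, …, d_{k-1})`. -/
def consCast {X : Type*} {k : ℕ} (c : X) (d : Fin (k - 1) → X) (j : Fin k) : X :=
  if h : (j : ℕ) = 0 then c else d ⟨(j : ℕ) - 1, by have := j.isLt; omega⟩

/-- The flat (Euclidean) conformal Killing equation on `k`-forms: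
`σ` is smooth on `U`, valued in alternating maps, and there are smooth form-valued
`τ` (degree `k-1`) and `ρ` (degree `k+1`) with
`(Dσ(x)c)(a₁,…,a_k) = Σᵢ (-1)^(i+1) ⟨c,aᵢ⟩ τ(x)(a₁,…,âᵢ,…,a_k) + ρ(x)(c,a₁,…,a_k)`. -/
def FlatCKF (n k : ℕ) (U : Set (Euc n)) (σ : Euc n → FormML n k) : Prop :=
  ContDiffOn ℝ (⊤ : ℕ∞) σ U ∧ (∀ x ∈ U, IsAlt (σ x)) ∧
  ∃ (τ : Euc n → FormML n (k - 1)) (ρ : Euc n → FormML n (k + 1)),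
    ContDiffOn ℝ (⊤ : ℕ∞) τ U ∧ ContDiffOn ℝ (⊤ : ℕ∞) ρ U ∧
    (∀ x ∈ U, IsAlt (τ x)) ∧ (∀ x ∈ U, IsAlt (ρ x)) ∧
    ∀ x ∈ U, ∀ (c : Euc n) (a : Fin k → Euc n),
      (fderiv ℝ σ x c) a =
        (∑ i : Fin k, (-1 : ℝ) ^ (i : ℕ) * ⟪c, a i⟫ * τ x (omitArg i a))
        + ρ x (consCast c a)


/-- The symmetric 2-tensor `S(x)(a,b) = Σ_{p₂,…,p_k} σ(x)(a,e_{p₂},…,e_{p_k}) ·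
σ(x)(b,e_{p₂},…,e_{p_k})` built from a `k`-form `σ`. -/
def symSq (n k : ℕ) (σ : Euc n → FormML n k) (y : Euc n) (a b : Euc n) : ℝ :=
  ∑ p : Fin (k - 1) → Fin n,
    σ y (consCast a fun j => EuclideanSpace.single (p j) (1 : ℝ)) *
    σ y (consCast b fun j => EuclideanSpace.single (p j) (1 : ℝ))

/-- The alternating map underlying a form. -/
def IsAlt.toAlternatingMap {n k : ℕ} {f : FormML n k} (hf : IsAlt f) :
    Euc n [⋀^Fin k]→ₗ[ℝ] ℝ :=
  { f.toMultilinearMap with map_eq_zero_of_eq' := fun v i j h hij => hf v i j hij h }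

theorem IsAlt.map_swap {n k : ℕ} {f : FormML n k} (hf : IsAlt f) (v : Fin k → Euc n)
    {i j : Fin k} (hij : i ≠ j) : f (v ∘ Equiv.swap i j) = -f v :=
  hf.toAlternatingMap.map_swap v hij

theorem consCast_eq_cons {X : Type*} {m : ℕ} (c : X) (d : Fin m → X) :
    consCast (k := m + 1) c d = (Fin.cons c d : Fin (m + 1) → X) := by
  funext j
  refine Fin.cases ?_ (fun j => ?_) j <;> simp [consCast]

theorem omitArg_eq_succAbove {X : Type*} {m : ℕ} (i : Fin (m + 1)) (a : Fin (m + 1) → X) :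
    omitArg i a = fun j : Fin m => a (i.succAbove j) := by
  funext j
  by_cases h : (j : ℕ) < (i : ℕ)
  · have h' : j.castSucc < i := h
    rw [Fin.succAbove_of_castSucc_lt _ _ h']
    simp only [omitArg, h, if_true]
    rfl
  · have h' : i ≤ j.castSucc := not_lt.mp h
    rw [Fin.succAbove_of_le_castSucc _ _ h']
    simp only [omitArg, h, if_false]
    rfl

theorem IsAlt.map_cons_cons_swap {n m : ℕ} {f : FormML n (m + 2)} (hf : IsAlt f)
    (a b : Euc n) (v : Fin m → Euc n) :
    f (Fin.cons a (Fin.cons b v : Fin (m + 1) → Euc n)) =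
      -f (Fin.cons b (Fin.cons a v : Fin (m + 1) → Euc n)) := by
  rw [← hf.map_swap _ (Fin.zero_ne_one (n := m))]
  congr 1
  funext j
  refine Fin.cases ?_ (fun j => Fin.cases ?_ (fun j => ?_) j) j
  · simp
  · simp
  · rw [Function.comp_apply, Equiv.swap_apply_of_ne_of_ne (Fin.succ_ne_zero _)]
    · simp
    · simp [Fin.ext_iff]

theorem IsAlt.map_cons_insertNth_swap {n m : ℕ} {f : FormML n (m + 2)} (hf : IsAlt f)
    (j : Fin (m + 1)) (a c : Euc n) (v : Fin m → Euc n) :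
    f (Fin.cons c (j.insertNth a v : Fin (m + 1) → Euc n)) =
      -f (Fin.cons a (j.insertNth c v : Fin (m + 1) → Euc n)) := by
  rw [← hf.map_swap _ (Fin.succ_ne_zero j).symm]
  congr 1
  funext l
  refine Fin.cases ?_ (fun l => Fin.succAboveCases j ?_ (fun l => ?_) l) l
  · simp
  · simp
  · rw [Function.comp_apply, Equiv.swap_apply_of_ne_of_ne (Fin.succ_ne_zero _)]
    · simp
    · simp [Fin.succAbove_ne]

theorem sum_coord_mul_map_update {n k : ℕ} (f : FormML n k) (v : Fin k → Euc n) (j : Fin k)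
    (a : Euc n) :
    ∑ i, a i * f (Function.update v j (EuclideanSpace.single i 1)) =
      f (Function.update v j a) := by
  have h := map_sum (f.toMultilinearMap.toLinearMap v j)
    (fun i => a i • EuclideanSpace.single i (1 : ℝ)) Finset.univ
  have ha : ∑ i, a i • EuclideanSpace.single i (1 : ℝ) = a := by
    simpa using (EuclideanSpace.basisFun (Fin n) ℝ).sum_repr a
  rw [ha] at h
  simpa using h.symm

/-- Contracting `τ` (with the `j`-th summation index omitted) against `σ`, the free index
being contracted with `a`, is antisymmetric in `a` and the first argument of `σ`. -/
theorem contraction_antisymm {n m : ℕ} {s : FormML n (m + 1)} (hs : IsAlt s)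
    (t : FormML n m) (j : Fin m) (a b c : Euc n) :
    ∑ p : Fin m → Fin n, ⟪a, EuclideanSpace.single (p j) (1 : ℝ)⟫ *
      t (fun l => (Fin.cons b (fun i => EuclideanSpace.single (p i) (1 : ℝ)) :
        Fin (m + 1) → Euc n) (j.succ.succAbove l)) *
      s (Fin.cons c fun i => EuclideanSpace.single (p i) (1 : ℝ)) =
    -∑ p : Fin m → Fin n, ⟪c, EuclideanSpace.single (p j) (1 : ℝ)⟫ *
      t (fun l => (Fin.cons b (fun i => EuclideanSpace.single (p i) (1 : ℝ)) :
        Fin (m + 1) → Euc n) (j.succ.succAbove l)) *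
      s (Fin.cons a fun i => EuclideanSpace.single (p i) (1 : ℝ)) := by
  obtain _ | m := m
  · exact j.elim0
  have key : ∀ a c : Euc n,
      ∑ p : Fin (m + 1) → Fin n, ⟪a, EuclideanSpace.single (p j) (1 : ℝ)⟫ *
        t (fun l => (Fin.cons b (fun i => EuclideanSpace.single (p i) (1 : ℝ)) :
          Fin (m + 2) → Euc n) (j.succ.succAbove l)) *
        s (Fin.cons c fun i => EuclideanSpace.single (p i) (1 : ℝ)) =
      ∑ q : Fin m → Fin n,
        t (Fin.cons b fun i => EuclideanSpace.single (q i) (1 : ℝ)) *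
        s (Fin.cons c (j.insertNth a (fun i => EuclideanSpace.single (q i) (1 : ℝ)) :
          Fin (m + 1) → Euc n)) := by
    intro a c
    rw [← (Fin.insertNthEquiv (fun _ => Fin n) j).sum_comp, Fintype.sum_prod_type_right]
    refine Finset.sum_congr rfl fun q _ => ?_
    have hupd : ∀ x : Euc n,
        (Fin.cons c (j.insertNth x (fun i => EuclideanSpace.single (q i) (1 : ℝ)) :
          Fin (m + 1) → Euc n) : Fin (m + 2) → Euc n) =
        Function.update (Fin.cons c (j.insertNth 0 (fun i => EuclideanSpace.single (q i) (1 : ℝ)) :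
          Fin (m + 1) → Euc n)) j.succ x := by
      intro x
      rw [← Fin.cons_update, Fin.update_insertNth]
    rw [hupd, ← sum_coord_mul_map_update, Finset.mul_sum]
    refine Finset.sum_congr rfl fun i _ => ?_
    have hins : (fun l => EuclideanSpace.single
        ((j.insertNth i q : Fin (m + 1) → Fin n) l) (1 : ℝ)) =
        (j.insertNth (EuclideanSpace.single i (1 : ℝ))
          (fun l => EuclideanSpace.single (q l) (1 : ℝ)) : Fin (m + 1) → Euc n) := by
      funext l
      refine Fin.succAboveCases j ?_ (fun l => ?_) l <;> simp
    have homit : (fun l => (Fin.cons b (fun l => EuclideanSpace.single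
          ((j.insertNth i q : Fin (m + 1) → Fin n) l) (1 : ℝ)) :
          Fin (m + 2) → Euc n) (j.succ.succAbove l)) =
        Fin.cons b fun l => EuclideanSpace.single (q l) (1 : ℝ) := by
      rw [hins]
      funext l
      refine Fin.cases ?_ (fun l => ?_) l <;> simp
    simp only [Fin.insertNthEquiv_apply]
    rw [homit, hins, hupd]
    simp [EuclideanSpace.inner_single_right]
    ring
  rw [key, key, ← Finset.sum_neg_distrib]
  refine Finset.sum_congr rfl fun q _ => ?_
  rw [hs.map_cons_insertNth_swap j a c]
  ring

/-- The pointwise algebraic identity behind the theorem: here `s`, `L`, `t`, `r` are the values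
of `σ`, `Dσ`, `τ`, `ρ` at a point. -/
theorem symmetrized_contraction_eq {n m : ℕ} {s : FormML n (m + 1)} (hs : IsAlt s)
    (t : FormML n m) {r : FormML n (m + 2)} (hr : IsAlt r) (L : Euc n → FormML n (m + 1))
    (hL : ∀ c (a : Fin (m + 1) → Euc n), L c a =
      (∑ i : Fin (m + 1), (-1 : ℝ) ^ (i : ℕ) * ⟪c, a i⟫ * t fun l => a (i.succAbove l)) +
        r (Fin.cons c a))
    (F : Euc n → Euc n → Euc n → ℝ)
    (hF : ∀ a b c, F a b c = ∑ p : Fin m → Fin n,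
      L a (Fin.cons b fun i => EuclideanSpace.single (p i) (1 : ℝ)) *
      s (Fin.cons c fun i => EuclideanSpace.single (p i) (1 : ℝ)))
    (T : Euc n → ℝ)
    (hT : ∀ c, T c = ∑ p : Fin m → Fin n,
      t (fun i => EuclideanSpace.single (p i) (1 : ℝ)) *
      s (Fin.cons c fun i => EuclideanSpace.single (p i) (1 : ℝ)))
    (a b c : Euc n) :
    (F a b c + F a c b) + (F b c a + F b a c) + (F c a b + F c b a) =
      ⟪a, b⟫ * (2 * T c) + ⟪b, c⟫ * (2 * T a) + ⟪c, a⟫ * (2 * T b) := by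
  obtain ⟨G, hG⟩ : ∃ G : Euc n → Euc n → Euc n → ℝ, ∀ a b c, G a b c =
      ∑ j : Fin m, (-1 : ℝ) ^ ((j : ℕ) + 1) *
        ∑ p : Fin m → Fin n, ⟪a, EuclideanSpace.single (p j) (1 : ℝ)⟫ *
        t (fun l => (Fin.cons b (fun i => EuclideanSpace.single (p i) (1 : ℝ)) :
          Fin (m + 1) → Euc n) (j.succ.succAbove l)) *
        s (Fin.cons c fun i => EuclideanSpace.single (p i) (1 : ℝ)) := ⟨_, fun _ _ _ => rfl⟩
  obtain ⟨R, hR⟩ : ∃ R : Euc n → Euc n → Euc n → ℝ, ∀ a b c, R a b c =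
      ∑ p : Fin m → Fin n,
        r (Fin.cons a (Fin.cons b (fun i => EuclideanSpace.single (p i) (1 : ℝ)) :
          Fin (m + 1) → Euc n)) *
        s (Fin.cons c fun i => EuclideanSpace.single (p i) (1 : ℝ)) := ⟨_, fun _ _ _ => rfl⟩
  have hGa : ∀ a b c, G a b c = -G c b a := by
    intro a b c
    rw [hG, hG, ← Finset.sum_neg_distrib]
    refine Finset.sum_congr rfl fun j _ => ?_
    rw [contraction_antisymm hs t j a b c, mul_neg]
  have hRa : ∀ a b c, R a b c = -R b a c := by
    intro a b c
    rw [hR, hR, ← Finset.sum_neg_distrib]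
    refine Finset.sum_congr rfl fun p _ => ?_
    rw [hr.map_cons_cons_swap a b, neg_mul]
  have hdecomp : ∀ a b c, F a b c = ⟪a, b⟫ * T c + G a b c + R a b c := by
    intro a b c
    simp only [hF, hT, hG, hR, hL, Fin.sum_univ_succ, Finset.mul_sum]
    rw [Finset.sum_comm (γ := Fin m), ← Finset.sum_add_distrib, ← Finset.sum_add_distrib]
    refine Finset.sum_congr rfl fun p _ => ?_
    simp only [add_mul, Finset.sum_mul, Fin.cons_zero, Fin.cons_succ, Fin.val_zero, pow_zero,
      one_mul, Fin.val_succ, Fin.zero_succAbove]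
    congr 2
    · ring
    · exact Finset.sum_congr rfl fun j _ => by ring
  rw [hdecomp a b c, hdecomp a c b, hdecomp b c a, hdecomp b a c, hdecomp c a b, hdecomp c b a,
    real_inner_comm b a, real_inner_comm c b, real_inner_comm a c]
  linarith [hGa a b c, hGa a c b, hGa b a c, hRa a b c, hRa b c a, hRa c a b]

/-- The derivative of `symSq` by the product rule. -/
theorem fderiv_symSq {n m : ℕ} {σ : Euc n → FormML n (m + 1)} {x : Euc n}
    (hσ : DifferentiableAt ℝ σ x) (a b c : Euc n) :
    fderiv ℝ (fun y => symSq n (m + 1) σ y b c) x a =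
      (∑ p : Fin m → Fin n,
        fderiv ℝ σ x a (Fin.cons b fun i => EuclideanSpace.single (p i) (1 : ℝ)) *
        σ x (Fin.cons c fun i => EuclideanSpace.single (p i) (1 : ℝ))) +
      ∑ p : Fin m → Fin n,
        fderiv ℝ σ x a (Fin.cons c fun i => EuclideanSpace.single (p i) (1 : ℝ)) *
        σ x (Fin.cons b fun i => EuclideanSpace.single (p i) (1 : ℝ)) := by
  have happ : ∀ v : Fin (m + 1) → Euc n, HasFDerivAt (fun y => σ y v)
      ((ContinuousMultilinearMap.apply ℝ (fun _ : Fin (m + 1) => Euc n) ℝ v).comp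
        (fderiv ℝ σ x)) x := fun v =>
    (ContinuousMultilinearMap.apply ℝ (fun _ : Fin (m + 1) => Euc n) ℝ v).hasFDerivAt.comp x
      hσ.hasFDerivAt
  have hsum := HasFDerivAt.fun_sum (u := Finset.univ) fun (p : Fin m → Fin n) _ =>
    (happ (Fin.cons b fun i => EuclideanSpace.single (p i) (1 : ℝ))).mul
      (happ (Fin.cons c fun i => EuclideanSpace.single (p i) (1 : ℝ)))
  have heq : (fun y => symSq n (m + 1) σ y b c) = fun y => ∑ p : Fin m → Fin n,
      σ y (Fin.cons b fun i => EuclideanSpace.single (p i) (1 : ℝ)) *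
      σ y (Fin.cons c fun i => EuclideanSpace.single (p i) (1 : ℝ)) := by
    funext y
    simp only [symSq]
    refine Finset.sum_congr rfl fun p _ => ?_
    rw [consCast_eq_cons, consCast_eq_cons]
    rfl
  rw [heq]
  refine (congrArg (fun f => f a) hsum.fderiv).trans ?_
  rw [← Finset.sum_add_distrib, sum_apply]
  refine Finset.sum_congr rfl fun p _ => ?_
  simp
  ring

/-- The linear functional `c ↦ 2 Σ_p τ(e_p) σ(c, e_p)`. -/
def traceFunctional {n m : ℕ} (s : FormML n (m + 1)) (t : FormML n m) : Euc n →L[ℝ] ℝ :=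
  ∑ p : Fin m → Fin n, (2 * t fun i => EuclideanSpace.single (p i) (1 : ℝ)) •
    s.toContinuousLinearMap (Fin.cons 0 fun i => EuclideanSpace.single (p i) (1 : ℝ)) 0

theorem traceFunctional_apply {n m : ℕ} (s : FormML n (m + 1)) (t : FormML n m) (c : Euc n) :
    traceFunctional s t c = 2 * ∑ p : Fin m → Fin n,
      t (fun i => EuclideanSpace.single (p i) (1 : ℝ)) *
      s (Fin.cons c fun i => EuclideanSpace.single (p i) (1 : ℝ)) := by
  simp [traceFunctional, Finset.mul_sum, mul_assoc,
    ContinuousMultilinearMap.toContinuousLinearMap]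

theorem contDiffOn_traceFunctional {n m : ℕ} {U : Set (Euc n)} {σ : Euc n → FormML n (m + 1)}
    {τ : Euc n → FormML n m} (hσ : ContDiffOn ℝ (⊤ : ℕ∞) σ U)
    (hτ : ContDiffOn ℝ (⊤ : ℕ∞) τ U) :
    ContDiffOn ℝ (⊤ : ℕ∞) (fun x => traceFunctional (σ x) (τ x)) U := by
  have happ : ∀ {l : ℕ} {f : Euc n → FormML n l}, ContDiffOn ℝ (⊤ : ℕ∞) f U →
      ∀ v : Fin l → Euc n, ContDiffOn ℝ (⊤ : ℕ∞) (fun x => f x v) U := fun hf v =>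
    (ContinuousMultilinearMap.apply ℝ _ ℝ v).contDiff.comp_contDiffOn hf
  rw [contDiffOn_clm_apply]
  intro c
  simp only [traceFunctional_apply]
  exact contDiffOn_const.mul (ContDiffOn.sum fun p _ => (happ hτ _).mul (happ hσ _))

/-- If `σ` is a flat conformal Killing `k`-form then the symmetrized
derivative of `S(x)(a,b) = Σ σ(x)(a,e…)σ(x)(b,e…)` is pure trace, i.e. the trace-free
part of `S` is a conformal Killing 2-tensor. -/
theorem flat_conformal_killing_square_is_conformal_Killing_tensor
    (n k : ℕ) (hn : 3 ≤ n) (hk1 : 1 ≤ k) (hkn : k ≤ n - 1)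
    (U : Set (Euc n)) (hU : IsOpen U)
    (σ : Euc n → FormML n k) (hσ : FlatCKF n k U σ) :
    ∃ lam : Euc n → (Euc n →L[ℝ] ℝ),
      ContDiffOn ℝ (⊤ : ℕ∞) lam U ∧
      ∀ x ∈ U, ∀ a b c : Euc n,
        fderiv ℝ (fun y => symSq n k σ y b c) x a
        + fderiv ℝ (fun y => symSq n k σ y c a) x b
        + fderiv ℝ (fun y => symSq n k σ y a b) x c
        = ⟪a, b⟫ * lam x c + ⟪b, c⟫ * lam x a + ⟪c, a⟫ * lam x b := by
  obtain ⟨m, rfl⟩ : ∃ m, k = m + 1 := ⟨k - 1, by omega⟩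
  obtain ⟨hsm, halt, τ, ρ, hτ, -, -, hρalt, heq⟩ := hσ
  refine ⟨fun x => traceFunctional (σ x) (τ x), contDiffOn_traceFunctional hsm hτ, ?_⟩
  intro x hx a b c
  have hdiff : DifferentiableAt ℝ σ x :=
    (hsm.differentiableOn (by simp)).differentiableAt (hU.mem_nhds hx)
  simp only [fderiv_symSq hdiff, traceFunctional_apply]
  refine symmetrized_contraction_eq (halt x hx) (τ x) (hρalt x hx) (fun c => fderiv ℝ σ x c)
    (fun c v => ?_) _ (fun _ _ _ => rfl) _ (fun _ => rfl) a b c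
  refine (heq x hx c v).trans ?_
  rw [consCast_eq_cons]
  simp only [omitArg_eq_succAbove]
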